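/- Let T be a tree of order n(T) ≥ 3 with γ_t^{oi}(S(T)) = (4n(T) − l(T) − s(T))/3, let v_1 v_2 ⋯ v_{d+1} be a diametral path in T (a path of length equal to the diameter d of T), and suppose v_2 has degree 2 and v_3 has degree at least 3 in T. Then the tree T' = T − {v_1, v_2} satisfies γ_t^{oi}(S(T')) = (4n(T') − l(T') − s(T'))/3. -/

import Mathlib

open SimpleGraph

universe u

/-- A total outer-independent dominating set: every vertex has a neighbor in `D`,
and the complement of `D` is an independent set. -/
def IsTOIDS {V : Type u} (G : SimpleGraph V) (D : Set V) : Prop :=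
  (∀ v : V, ∃ u ∈ D, G.Adj v u) ∧ ∀ u ∉ D, ∀ w ∉ D, ¬ G.Adj u w

/-- The total outer-independent domination number. -/
noncomputable def toidNumber {V : Type u} (G : SimpleGraph V) : ℕ :=
  sInf {n : ℕ | ∃ D : Set V, IsTOIDS G D ∧ D.ncard = n}

/-- The subdivision graph: each edge is replaced by a new vertex adjacent exactly to
its two endpoints. -/
def subdivision {V : Type u} (G : SimpleGraph V) : SimpleGraph (V ⊕ G.edgeSet) :=
  SimpleGraph.fromRel fun x y =>
    ∃ (v : V) (e : G.edgeSet), x = Sum.inl v ∧ y = Sum.inr e ∧ v ∈ (e : Sym2 V)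

/-- A leaf: a vertex with exactly one neighbor. -/
def IsLeafVert {V : Type u} (G : SimpleGraph V) (v : V) : Prop := ∃! u, G.Adj v u

/-- A support vertex: a vertex adjacent to a leaf. -/
def IsSupportVert {V : Type u} (G : SimpleGraph V) (v : V) : Prop :=
  ∃ u, G.Adj v u ∧ IsLeafVert G u

/-- A strong support vertex: a vertex adjacent to at least two leaves. -/
def IsStrongSupportVert {V : Type u} (G : SimpleGraph V) (v : V) : Prop :=
  ∃ u w, u ≠ w ∧ G.Adj v u ∧ G.Adj v w ∧ IsLeafVert G u ∧ IsLeafVert G w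

/-- A strong leaf: a leaf adjacent to a strong support vertex. -/
def IsStrongLeaf {V : Type u} (G : SimpleGraph V) (v : V) : Prop :=
  IsLeafVert G v ∧ ∃ u, G.Adj v u ∧ IsStrongSupportVert G u

/-- A weak leaf: a leaf that is not a strong leaf. -/
def IsWeakLeaf {V : Type u} (G : SimpleGraph V) (v : V) : Prop :=
  IsLeafVert G v ∧ ¬ IsStrongLeaf G v

/-- A semi-support vertex: neither a leaf nor a support vertex, but adjacent to a
support vertex. -/
def IsSemiSupportVert {V : Type u} (G : SimpleGraph V) (v : V) : Prop :=
  ¬ IsLeafVert G v ∧ ¬ IsSupportVert G v ∧ ∃ u, G.Adj v u ∧ IsSupportVert G u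

/-- The number of leaves, with the convention that `P₂` has exactly one leaf. -/
noncomputable def leafCount {V : Type u} (G : SimpleGraph V) : ℕ :=
  if Nat.card V = 2 then 1 else {v | IsLeafVert G v}.ncard

/-- The number of support vertices, with the convention that `P₂` has exactly one
support vertex. -/
noncomputable def supportCount {V : Type u} (G : SimpleGraph V) : ℕ :=
  if Nat.card V = 2 then 1 else {v | IsSupportVert G v}.ncard

/-- The graph obtained from `G` by attaching a path `P_r` to the vertex `v`:
the new vertices form a path `p₀ p₁ ⋯ p_{r-1}` and `v` is joined to the end `p₀`. -/
def attachPath {V : Type u} (G : SimpleGraph V) (v : V) (r : ℕ) :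
    SimpleGraph (V ⊕ Fin r) :=
  SimpleGraph.fromRel fun x y =>
    (∃ a b, x = Sum.inl a ∧ y = Sum.inl b ∧ G.Adj a b) ∨
    (∃ i j : Fin r, x = Sum.inr i ∧ y = Sum.inr j ∧ (j : ℕ) = (i : ℕ) + 1) ∨
    (∃ i : Fin r, x = Sum.inl v ∧ y = Sum.inr i ∧ (i : ℕ) = 0)

/-- The graph obtained from `G` by adding a disjoint copy of the tree `Q_r`
(`r` paths `P₃` joined to a central vertex) and identifying the central vertex
of `Q_r` with the vertex `v` of `G`. -/
def attachQ {V : Type u} (G : SimpleGraph V) (v : V) (r : ℕ) :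
    SimpleGraph (V ⊕ Fin r × Fin 3) :=
  SimpleGraph.fromRel fun x y =>
    (∃ a b, x = Sum.inl a ∧ y = Sum.inl b ∧ G.Adj a b) ∨
    (∃ i : Fin r, x = Sum.inl v ∧ y = Sum.inr (i, 0)) ∨
    (∃ (i : Fin r) (j k : Fin 3),
      x = Sum.inr (i, j) ∧ y = Sum.inr (i, k) ∧ (k : ℕ) = (j : ℕ) + 1)

/-- The family `F`: all trees obtainable from `P₂` by repeatedly
(F1) attaching `P₁` to a support vertex, (F2) attaching `P₂` to a support or
semi-support vertex, (F3) attaching `P₃` to a weak leaf. -/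
inductive InFamilyF : {W : Type u} → SimpleGraph W → Prop
  | base {W : Type u} (G : SimpleGraph W) (e : G ≃g SimpleGraph.pathGraph 2) :
      InFamilyF G
  | op1 {W : Type u} {G' : SimpleGraph W} {v : W} (hv : IsSupportVert G' v)
      (hF : InFamilyF G') {U : Type u} (G : SimpleGraph U)
      (e : G ≃g attachPath G' v 1) : InFamilyF G
  | op2 {W : Type u} {G' : SimpleGraph W} {v : W}
      (hv : IsSupportVert G' v ∨ IsSemiSupportVert G' v)
      (hF : InFamilyF G') {U : Type u} (G : SimpleGraph U)
      (e : G ≃g attachPath G' v 2) : InFamilyF G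
  | op3 {W : Type u} {G' : SimpleGraph W} {v : W} (hv : IsWeakLeaf G' v)
      (hF : InFamilyF G') {U : Type u} (G : SimpleGraph U)
      (e : G ≃g attachPath G' v 3) : InFamilyF G

/-- The family `𝒯`: all trees obtainable from `P₂` by repeatedly
(O1) attaching `P₁` to a support vertex, (O2) attaching `P₃` to a support vertex or a
weak leaf, (O3) adding a copy of `Q_r` (`r ≥ 2`) identifying its central vertex with a
weak leaf. -/
inductive InFamilyT : {W : Type u} → SimpleGraph W → Prop
  | base {W : Type u} (G : SimpleGraph W) (e : G ≃g SimpleGraph.pathGraph 2) :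
      InFamilyT G
  | op1 {W : Type u} {G' : SimpleGraph W} {v : W} (hv : IsSupportVert G' v)
      (hF : InFamilyT G') {U : Type u} (G : SimpleGraph U)
      (e : G ≃g attachPath G' v 1) : InFamilyT G
  | op2 {W : Type u} {G' : SimpleGraph W} {v : W}
      (hv : IsSupportVert G' v ∨ IsWeakLeaf G' v)
      (hF : InFamilyT G') {U : Type u} (G : SimpleGraph U)
      (e : G ≃g attachPath G' v 3) : InFamilyT G
  | op3 {W : Type u} {G' : SimpleGraph W} {v : W} (hv : IsWeakLeaf G' v)
      (hF : InFamilyT G') {r : ℕ} (hr : 2 ≤ r) {U : Type u} (G : SimpleGraph U)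
      (e : G ≃g attachQ G' v r) : InFamilyT G

/-- A finite graph has at most as many vertices as edges and connected components together. -/
theorem card_le_card_edgeSet_add_card_connectedComponent {V : Type u} [Finite V]
    (H : SimpleGraph V) :
    Nat.card V ≤ Nat.card H.edgeSet + Nat.card H.ConnectedComponent := by
  classical
  let rep : V → V := fun v => (H.connectedComponentMk v).out
  have hrep : ∀ v, H.Reachable v (rep v) := fun v =>
    (SimpleGraph.ConnectedComponent.exact (H.connectedComponentMk v).out_eq).symm
  have hpar : ∀ v, v ≠ rep v → ∃ u, H.Adj v u ∧ H.dist u (rep v) < H.dist v (rep v) := by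
    intro v
    generalize hr : rep v = r
    intro hv
    obtain ⟨p, hp⟩ := (hr ▸ hrep v : H.Reachable v r).exists_walk_length_eq_dist
    cases p with
    | nil => exact absurd rfl hv
    | cons h q =>
      refine ⟨_, h, ?_⟩
      have := SimpleGraph.dist_le q
      simp only [SimpleGraph.Walk.length_cons] at hp
      omega
  choose! par hadj hlt using hpar
  let f : V → H.edgeSet ⊕ H.ConnectedComponent := fun v =>
    if h : v = rep v then Sum.inr (H.connectedComponentMk v)
    else Sum.inl ⟨s(v, par v), hadj v h⟩
  rw [← Nat.card_sum]
  refine Nat.card_le_card_of_injective f fun v v' hf => ?_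
  simp only [f] at hf
  split_ifs at hf with h h' h' <;>
    simp only [Sum.inr.injEq, Sum.inl.injEq, Subtype.ext_iff, Sym2.eq_iff] at hf
  · rw [h, h']
    simp only [rep, hf]
  · rcases hf with ⟨hv, -⟩ | ⟨hv, hv'⟩
    · exact hv
    · have hr : rep v = rep v' := by
        simp only [rep]
        congr 1
        exact SimpleGraph.ConnectedComponent.sound (hv' ▸ (hadj v h).reachable)
      have h1 := hlt v h
      have h2 := hlt v' h'
      rw [hv'] at h1
      rw [← hv, ← hr] at h2
      omega

/-- The counting inequality behind the lower bound: `I` is the set of original vertices outside a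
total outer-independent dominating set of the subdivision of `G`, and the edges of `H` are the
subdivision vertices inside it. -/
theorem card_add_three_mul_card_le {V : Type u} [Finite V] {G H : SimpleGraph V} (hHG : H ≤ G)
    {I : Set V} (hI : ∀ v ∈ I, ∀ u, G.Adj v u → H.Adj v u ∧ u ∉ I) (hdom : ∀ v, ∃ u, H.Adj v u) :
    Nat.card V + 3 * I.ncard ≤
      3 * Nat.card H.edgeSet + {v | IsLeafVert G v}.ncard + {v | IsSupportVert G v}.ncard := by
  classical
  choose nb hnb using hdom
  have hsnd : ∀ v, ¬ IsLeafVert G v → ∃ u, u ≠ nb v ∧ G.Adj v u := by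
    intro v hv
    by_contra! hcon
    exact hv ⟨nb v, hHG (hnb v), fun y hy => by_contra fun hne => hcon y hne hy⟩
  choose! nb' hnb'ne hnb' using hsnd
  let N : Set V := {v | v ∈ I ∧ ¬ IsLeafVert G v}
  let C₀ : Set H.ConnectedComponent := {K | ∀ v ∈ I, H.connectedComponentMk v ≠ K}
  have hcomp := card_le_card_edgeSet_add_card_connectedComponent H
  have hCsplit : C₀.ncard + C₀ᶜ.ncard = Nat.card H.ConnectedComponent :=
    Set.ncard_add_ncard_compl C₀
  have hIsplit : I.ncard ≤ N.ncard + {v | IsLeafVert G v}.ncard := by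
    refine le_trans (Set.ncard_le_ncard ?_) (Set.ncard_union_le _ _)
    intro v hv
    by_cases h : IsLeafVert G v
    · exact Or.inr h
    · exact Or.inl ⟨hv, h⟩
  have hedges : I.ncard + N.ncard + C₀.ncard ≤ Nat.card H.edgeSet := by
    let f : (I ⊕ N) ⊕ C₀ → H.edgeSet
      | .inl (.inl v) => ⟨s(v, nb v), hnb v⟩
      | .inl (.inr v) => ⟨s(v, nb' v), (hI v v.2.1 _ (hnb' v v.2.2)).1⟩
      | .inr K => ⟨s(K.1.out, nb K.1.out), hnb _⟩
    have hout : ∀ K : C₀, K.1.out ∉ I ∧ nb K.1.out ∉ I := fun K =>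
      ⟨fun h => K.2 _ h K.1.out_eq, fun h => K.2 _ h
        ((SimpleGraph.ConnectedComponent.sound (hnb K.1.out).reachable.symm).trans K.1.out_eq)⟩
    have hnbI : ∀ v ∈ I, nb v ∉ I := fun v hv => (hI v hv _ (hHG (hnb v))).2
    have hnbI' : ∀ v ∈ N, nb' v ∉ I := fun v hv => (hI v hv.1 _ (hnb' v hv.2)).2
    have hinj : Function.Injective f := by
      rintro ((⟨v, hv⟩ | ⟨v, hv⟩) | K) ((⟨v', hv'⟩ | ⟨v', hv'⟩) | K') h <;>
        simp only [f, Subtype.ext_iff, Sym2.eq_iff] at h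
      · grind
      · have := hnbI v hv
        have := hnbI' v' hv'
        have := hnb'ne v' hv'.2
        have := hv'.1
        grind
      · grind
      · have := hnbI v' hv'
        have := hnbI' v hv
        have := hnb'ne v hv.2
        have := hv.1
        grind
      · have := hv.1
        have := hv'.1
        grind
      · have := hv.1
        grind
      · grind
      · have := hv'.1
        grind
      · congr 1
        ext1
        rw [← K.1.out_eq, ← K'.1.out_eq]
        rcases h with ⟨h, -⟩ | ⟨h, -⟩
        · exact congrArg _ h
        · rw [show Quot.mk _ K.1.out = H.connectedComponentMk K.1.out from rfl, h]
          exact SimpleGraph.ConnectedComponent.sound (hnb K'.1.out).reachable.symm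
    simpa only [Nat.card_sum, Nat.card_coe_set_eq] using Nat.card_le_card_of_injective f hinj
  have hcomps : C₀ᶜ.ncard ≤ N.ncard + {v | IsSupportVert G v}.ncard := by
    have hex : ∀ K : (C₀ᶜ : Set _), ∃ v ∈ I, H.connectedComponentMk v = K.1 := fun K => by
      obtain ⟨K, hK⟩ := K
      simpa [C₀] using hK
    choose r hrI hrK using hex
    let f : (C₀ᶜ : Set _) → N ⊕ {v | IsSupportVert G v} := fun K =>
      if h : IsLeafVert G (r K) then .inr ⟨nb (r K), r K, (hHG (hnb _)).symm, h⟩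
      else .inl ⟨r K, hrI K, h⟩
    have hinj : Function.Injective f := by
      intro K K' h
      ext1
      rw [← hrK, ← hrK]
      by_cases h1 : IsLeafVert G (r K) <;> by_cases h2 : IsLeafVert G (r K') <;>
        simp only [f, h1, h2, dite_true, dite_false, reduceCtorEq, Sum.inr.injEq,
          Sum.inl.injEq, Subtype.ext_iff] at h
      · exact SimpleGraph.ConnectedComponent.sound
          ((hnb (r K)).reachable.trans (h ▸ (hnb (r K')).reachable.symm))
      · rw [h]
    simpa only [Nat.card_sum, Nat.card_coe_set_eq] using Nat.card_le_card_of_injective f hinj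
  omega

@[simp]
theorem subdivision_adj_inl_inl {V : Type u} (G : SimpleGraph V) (v w : V) :
    ¬ (subdivision G).Adj (Sum.inl v) (Sum.inl w) := by
  simp [subdivision]

@[simp]
theorem subdivision_adj_inr_inr {V : Type u} (G : SimpleGraph V) (e f : G.edgeSet) :
    ¬ (subdivision G).Adj (Sum.inr e) (Sum.inr f) := by
  simp [subdivision]

@[simp]
theorem subdivision_adj_inl_inr {V : Type u} (G : SimpleGraph V) (v : V) (e : G.edgeSet) :
    (subdivision G).Adj (Sum.inl v) (Sum.inr e) ↔ v ∈ (e : Sym2 V) := by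
  simp [subdivision]

@[simp]
theorem subdivision_adj_inr_inl {V : Type u} (G : SimpleGraph V) (v : V) (e : G.edgeSet) :
    (subdivision G).Adj (Sum.inr e) (Sum.inl v) ↔ v ∈ (e : Sym2 V) := by
  rw [SimpleGraph.adj_comm, subdivision_adj_inl_inr]

/-- The description inside `G` of a total outer-independent dominating set of `subdivision G`:
`A` is the set of its original vertices and the edges of `H` are its subdivision vertices. -/
structure IsTOIDPair {V : Type u} (G H : SimpleGraph V) (A : Set V) : Prop where
  le : H ≤ G
  exists_adj : ∀ v, ∃ u, H.Adj v u
  cover : ∀ u v, G.Adj u v → u ∈ A ∨ v ∈ A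
  outer : ∀ u v, G.Adj u v → u ∈ A ∨ H.Adj u v

theorem isTOIDS_subdivision_iff {V : Type u} {G H : SimpleGraph V} {A : Set V}
    {D : Set (V ⊕ G.edgeSet)} (hHG : H ≤ G) (hA : ∀ v, Sum.inl v ∈ D ↔ v ∈ A)
    (hH : ∀ e : G.edgeSet, Sum.inr e ∈ D ↔ (e : Sym2 V) ∈ H.edgeSet) :
    IsTOIDS (subdivision G) D ↔ IsTOIDPair G H A := by
  constructor
  · rintro ⟨hdom, hind⟩
    refine ⟨hHG, fun v => ?_, fun u v huv => ?_, fun u v huv => ?_⟩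
    · obtain ⟨x | e, hx, hadj⟩ := hdom (Sum.inl v)
      · simp at hadj
      · rw [subdivision_adj_inl_inr] at hadj
        obtain ⟨u, hu⟩ := hadj
        refine ⟨u, ?_⟩
        have := (hH e).1 hx
        rwa [hu] at this
    · obtain ⟨x | e, hx, hadj⟩ := hdom (Sum.inr ⟨s(u, v), huv⟩)
      · rw [subdivision_adj_inr_inl, Sym2.mem_iff] at hadj
        rw [hA] at hx
        rcases hadj with rfl | rfl
        · exact Or.inl hx
        · exact Or.inr hx
      · simp at hadj
    · by_contra! hcon
      refine hind (Sum.inl u) (by rw [hA]; exact hcon.1) (Sum.inr ⟨s(u, v), huv⟩)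
        (by rw [hH]; exact hcon.2) (by simp)
  · intro h
    have hout : ∀ v ∉ D, ∀ e ∉ D, ∀ x f, v = Sum.inl x → e = Sum.inr f →
        ¬ (subdivision G).Adj v e := by
      rintro _ hv _ he x ⟨f, hf⟩ rfl rfl hadj
      rw [hA] at hv
      rw [hH] at he
      rw [subdivision_adj_inl_inr] at hadj
      obtain ⟨y, rfl⟩ := hadj
      exact (h.outer x y hf).elim hv he
    constructor
    · rintro (v | ⟨e, he⟩)
      · obtain ⟨u, hu⟩ := h.exists_adj v
        exact ⟨Sum.inr ⟨s(v, u), hHG hu⟩, (hH _).2 hu, by simp⟩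
      · induction e with
        | _ u v =>
          rcases h.cover u v he with hu | hv
          · exact ⟨Sum.inl u, (hA u).2 hu, by simp⟩
          · exact ⟨Sum.inl v, (hA v).2 hv, by simp⟩
    · rintro (v | e) hx (w | f) hy
      · simp
      · exact hout _ hx _ hy v f rfl rfl
      · rw [SimpleGraph.adj_comm]
        exact hout _ hy _ hx w e rfl rfl
      · simp

theorem ncard_eq_of_forall_mem_iff {V : Type u} [Finite V] {G H : SimpleGraph V} {A : Set V}
    {D : Set (V ⊕ G.edgeSet)} (hHG : H ≤ G) (hA : ∀ v, Sum.inl v ∈ D ↔ v ∈ A)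
    (hH : ∀ e : G.edgeSet, Sum.inr e ∈ D ↔ (e : Sym2 V) ∈ H.edgeSet) :
    D.ncard = A.ncard + H.edgeSet.ncard := by
  let f : A ⊕ H.edgeSet → V ⊕ G.edgeSet :=
    Sum.map Subtype.val (Set.inclusion (SimpleGraph.edgeSet_mono hHG))
  have hf : Function.Injective f :=
    Subtype.val_injective.sumMap (Set.inclusion_injective _)
  have hD : D = Set.range f := by
    ext (v | e)
    · simp [f, hA]
    · rw [hH]
      constructor
      · exact fun he => ⟨Sum.inr ⟨e, he⟩, rfl⟩
      · rintro ⟨v | ⟨e', he'⟩, h⟩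
        · simp [f] at h
        · simp only [f, Sum.map_inr, Sum.inr.injEq] at h
          rw [← h]
          exact he'
  rw [hD, ← Nat.card_coe_set_eq, Nat.card_range_of_injective hf, Nat.card_sum,
    Nat.card_coe_set_eq, Nat.card_coe_set_eq]

theorem IsTOIDPair.exists_isTOIDS {V : Type u} [Finite V] {G H : SimpleGraph V} {A : Set V}
    (h : IsTOIDPair G H A) :
    ∃ D, IsTOIDS (subdivision G) D ∧ D.ncard = A.ncard + H.edgeSet.ncard := by
  let D : Set (V ⊕ G.edgeSet) := {x | Sum.elim (· ∈ A) (fun e => (e : Sym2 V) ∈ H.edgeSet) x}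
  have hA : ∀ v, Sum.inl v ∈ D ↔ v ∈ A := fun v => Iff.rfl
  have hH : ∀ e : G.edgeSet, Sum.inr e ∈ D ↔ (e : Sym2 V) ∈ H.edgeSet := fun e => Iff.rfl
  exact ⟨D, (isTOIDS_subdivision_iff h.le hA hH).2 h, ncard_eq_of_forall_mem_iff h.le hA hH⟩

theorem IsTOIDS.exists_isTOIDPair {V : Type u} [Finite V] {G : SimpleGraph V}
    {D : Set (V ⊕ G.edgeSet)} (h : IsTOIDS (subdivision G) D) :
    ∃ H A, IsTOIDPair G H A ∧ D.ncard = A.ncard + H.edgeSet.ncard := by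
  let H : SimpleGraph V := SimpleGraph.fromEdgeSet {e | ∃ he, Sum.inr ⟨e, he⟩ ∈ D}
  have hHG : H ≤ G := by
    intro u v huv
    exact ((SimpleGraph.fromEdgeSet_adj _).1 huv).1.1
  have hA : ∀ v, Sum.inl v ∈ D ↔ v ∈ Sum.inl ⁻¹' D := fun v => Iff.rfl
  have hH : ∀ e : G.edgeSet, Sum.inr e ∈ D ↔ (e : Sym2 V) ∈ H.edgeSet := by
    rintro ⟨e, he⟩
    rw [SimpleGraph.edgeSet_fromEdgeSet]
    exact ⟨fun h => ⟨⟨he, h⟩, G.not_isDiag_of_mem_edgeSet he⟩, fun h => h.1.2⟩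
  exact ⟨H, _, (isTOIDS_subdivision_iff hHG hA hH).1 h, ncard_eq_of_forall_mem_iff hHG hA hH⟩

theorem IsTOIDPair.toidNumber_le {V : Type u} [Finite V] {G H : SimpleGraph V} {A : Set V}
    (h : IsTOIDPair G H A) : toidNumber (subdivision G) ≤ A.ncard + H.edgeSet.ncard := by
  obtain ⟨D, hD, hcard⟩ := h.exists_isTOIDS
  exact Nat.sInf_le ⟨D, hD, hcard⟩

theorem IsTOIDPair.exists_ncard_eq_toidNumber {V : Type u} [Finite V] {G H₀ : SimpleGraph V}
    {A₀ : Set V} (h : IsTOIDPair G H₀ A₀) :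
    ∃ H A, IsTOIDPair G H A ∧ A.ncard + H.edgeSet.ncard = toidNumber (subdivision G) := by
  obtain ⟨D₀, hD₀, -⟩ := h.exists_isTOIDS
  obtain ⟨D, hD, hcard⟩ := Nat.sInf_mem
    (s := {n | ∃ D, IsTOIDS (subdivision G) D ∧ D.ncard = n}) ⟨_, D₀, hD₀, rfl⟩
  obtain ⟨H, A, hHA, hcard'⟩ := hD.exists_isTOIDPair
  exact ⟨H, A, hHA, hcard'.symm.trans hcard⟩

/-- The lower bound on the total outer-independent domination number of a subdivision graph. -/
theorem IsTOIDPair.four_mul_card_le {V : Type u} [Finite V] {G H : SimpleGraph V} {A : Set V}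
    (h : IsTOIDPair G H A) : 4 * Nat.card V ≤ 3 * (A.ncard + H.edgeSet.ncard) +
      {v | IsLeafVert G v}.ncard + {v | IsSupportVert G v}.ncard := by
  have hI : ∀ v ∈ Aᶜ, ∀ u, G.Adj v u → H.Adj v u ∧ u ∉ Aᶜ := fun v hv u huv =>
    ⟨(h.outer v u huv).resolve_left hv, fun hu => (h.cover v u huv).elim hv hu⟩
  have hle := card_add_three_mul_card_le h.le hI h.exists_adj
  have hcompl := Set.ncard_add_ncard_compl A
  rw [Nat.card_coe_set_eq] at hle
  omega

/-- Deleting a pendant path `a p` attached to a vertex `q` that keeps a neighbour. -/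
theorem IsTOIDPair.exists_induce {V : Type u} [Finite V] {G H : SimpleGraph V} {A : Set V}
    (h : IsTOIDPair G H A) {a p q r : V} (ha : ∀ x, G.Adj a x ↔ x = p)
    (hp : ∀ x, G.Adj p x ↔ x = a ∨ x = q) (haq : a ≠ q) (hr : G.Adj q r) (hrp : r ≠ p) :
    ∃ H' A', IsTOIDPair (G.induce {x | x ≠ a ∧ x ≠ p}) H' A' ∧
      A'.ncard + H'.edgeSet.ncard + 2 ≤ A.ncard + H.edgeSet.ncard := by
  classical
  have hap : G.Adj a p := (ha p).2 rfl
  have hpq : G.Adj p q := (hp q).2 (Or.inr rfl)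
  have hra : r ≠ a := by
    rintro rfl
    exact hpq.ne' ((ha q).1 hr.symm)
  have hHap : H.Adj a p := by
    obtain ⟨x, hx⟩ := h.exists_adj a
    rwa [(ha x).1 (h.le hx)] at hx
  let S : Set V := {x | x ≠ a ∧ x ≠ p}
  let q' : S := ⟨q, haq.symm, hpq.ne'⟩
  let r' : S := ⟨r, hra, hrp⟩
  have hqr' : (G.induce S).Adj q' r' := hr
  have hne : ∀ (v : S) (x : V), H.Adj v x → (v : V) ≠ q → x ∈ S := by
    intro v x hx hv
    refine ⟨?_, ?_⟩
    · rintro rfl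
      exact v.2.2 ((ha v).1 (h.le hx).symm)
    · rintro rfl
      exact ((hp v).1 (h.le hx).symm).elim v.2.1 hv
  have hA : (Subtype.val ⁻¹' A : Set S).ncard + 1 ≤ A.ncard := by
    have him : (Subtype.val '' (Subtype.val ⁻¹' A : Set S)).ncard =
        (Subtype.val ⁻¹' A : Set S).ncard := Set.ncard_image_of_injective _ Subtype.val_injective
    rw [← him, Nat.succ_le_iff]
    refine Set.ncard_lt_ncard ((Set.ssubset_iff_of_subset (by simp)).2 ?_)
    rcases h.cover a p hap with hmem | hmem
    · exact ⟨a, hmem, by simp [S]⟩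
    · exact ⟨p, hmem, by simp [S]⟩
  have hE : ∀ F : Set (Sym2 V), F ⊆ H.edgeSet → (∀ e ∈ F, p ∈ e) →
      (H.induce S).edgeSet.ncard + F.ncard ≤ H.edgeSet.ncard := by
    intro F hF hFp
    have him : (Sym2.map Subtype.val '' (H.induce S).edgeSet).ncard =
        (H.induce S).edgeSet.ncard :=
      Set.ncard_image_of_injective _ (Sym2.map.injective Subtype.val_injective)
    rw [← him, ← Set.ncard_union_eq]
    · refine Set.ncard_le_ncard (Set.union_subset ?_ hF)
      rintro _ ⟨e, he, rfl⟩
      induction e with | _ x y => exact he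
    · rw [Set.disjoint_left]
      rintro _ ⟨e, he, rfl⟩ hmem
      obtain ⟨x, -, hx⟩ := Sym2.mem_map.1 (hFp _ hmem)
      exact x.2.2 hx
  have hle : H.induce S ≤ G.induce S := fun x y hxy => h.le hxy
  by_cases hHpq : H.Adj p q
  · refine ⟨H.induce S ⊔ SimpleGraph.edge q' r', Subtype.val ⁻¹' A, ⟨?_, ?_, ?_, ?_⟩, ?_⟩
    · refine sup_le hle ?_
      rw [SimpleGraph.edge_le_iff]
      exact Or.inr hqr'
    · intro v
      by_cases hv : v = q'
      · subst hv
        exact ⟨r', Or.inr ((SimpleGraph.edge_adj _ _ _ _).2 ⟨Or.inl ⟨rfl, rfl⟩, hqr'.ne⟩)⟩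
      · obtain ⟨x, hx⟩ := h.exists_adj v
        exact ⟨⟨x, hne v x hx fun hv' => hv (Subtype.ext hv')⟩, Or.inl hx⟩
    · exact fun u v huv => h.cover u v huv
    · exact fun u v huv => (h.outer u v huv).imp id Or.inl
    · have h2 := hE {s(p, a), s(p, q)} (by
        rintro e (rfl | rfl)
        · exact hHap.symm
        · exact hHpq) (by
        rintro e (rfl | rfl) <;> simp)
      rw [Set.ncard_pair (by simp [haq, hpq.ne])] at h2
      have hsup : (H.induce S ⊔ SimpleGraph.edge q' r').edgeSet.ncard ≤
          (H.induce S).edgeSet.ncard + 1 := by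
        rw [SimpleGraph.edgeSet_sup, SimpleGraph.edgeSet_edge_of_ne hqr'.ne]
        exact (Set.ncard_union_le _ _).trans (by simp)
      omega
  · refine ⟨H.induce S, Subtype.val ⁻¹' A, ⟨hle, ?_, ?_, ?_⟩, ?_⟩
    · intro v
      obtain ⟨x, hx⟩ := h.exists_adj v
      by_cases hv : v = q'
      · refine ⟨⟨x, ?_, ?_⟩, hx⟩
        · rintro rfl
          exact v.2.2 ((ha v).1 (h.le hx).symm)
        · rintro rfl
          subst hv
          exact hHpq hx.symm
      · exact ⟨⟨x, hne v x hx fun hv' => hv (Subtype.ext hv')⟩, hx⟩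
    · exact fun u v huv => h.cover u v huv
    · exact fun u v huv => h.outer u v huv
    · have h1 := hE {s(p, a)} (by rintro e rfl; exact hHap.symm) (by rintro e rfl; simp)
      rw [Set.ncard_singleton] at h1
      omega

/-- The first vertex of a longest path in a tree has the second vertex as its only neighbour. -/
theorem SimpleGraph.IsTree.adj_start_iff_of_length_eq_diam {V : Type u} [Finite V]
    {T : SimpleGraph V} (hT : T.IsTree) {a b : V} {w : T.Walk a b} (hw : w.IsPath)
    (hd : w.length = T.diam) (hpos : 0 < w.length) (x : V) : T.Adj a x ↔ x = w.getVert 1 := by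
  classical
  constructor
  · intro hax
    by_cases hx : x ∈ w.support
    · have hpath : (hax.toWalk).IsPath := SimpleGraph.Walk.IsPath.of_adj hax
      have heq := (hT.isAcyclic.subsingleton_path _ _).elim ⟨_, hw.takeUntil hx⟩ ⟨_, hpath⟩
      have hlen : (w.takeUntil x hx).length = 1 := by
        rw [Subtype.mk.injEq] at heq
        rw [heq]
        rfl
      rw [← hlen, SimpleGraph.Walk.getVert_length_takeUntil]
    · have hpath : (SimpleGraph.Walk.cons hax.symm w).IsPath := hw.cons hx
      obtain ⟨p, hp, hplen⟩ := hT.connected.exists_path_of_dist x b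
      have heq := (hT.isAcyclic.subsingleton_path _ _).elim ⟨_, hpath⟩ ⟨_, hp⟩
      rw [Subtype.mk.injEq] at heq
      have := hT.connected.nonempty
      have hle : T.dist x b ≤ T.diam :=
        SimpleGraph.dist_le_diam (SimpleGraph.connected_iff_ediam_ne_top.1 hT.connected)
      rw [← hplen, ← heq, SimpleGraph.Walk.length_cons] at hle
      omega
  · rintro rfl
    simpa using w.adj_getVert_succ hpos

section PendantPath

variable {V : Type u} {G : SimpleGraph V} {a p q : V}

theorem IsLeafVert.of_induce_pendant (ha : ∀ x, G.Adj a x ↔ x = p)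
    (hp : ∀ x, G.Adj p x ↔ x = a ∨ x = q) {r₁ r₂ : V} (hr : r₁ ≠ r₂)
    (hr₁ : G.Adj q r₁) (hr₂ : G.Adj q r₂) (hr₁p : r₁ ≠ p) (hr₂p : r₂ ≠ p) (haq : a ≠ q)
    {v : {x : V | x ≠ a ∧ x ≠ p}} (hv : IsLeafVert (G.induce {x | x ≠ a ∧ x ≠ p}) v) :
    IsLeafVert G v := by
  have hna : ∀ x, G.Adj q x → x ≠ a := by
    rintro x hx rfl
    exact ((hp q).2 (Or.inr rfl)).ne' ((ha q).1 hx.symm)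
  have hvq : (v : V) ≠ q := by
    intro hvq
    have h := hv.unique (y₁ := ⟨r₁, hna _ hr₁, hr₁p⟩) (y₂ := ⟨r₂, hna _ hr₂, hr₂p⟩)
      (hvq ▸ hr₁ : G.Adj v r₁) (hvq ▸ hr₂ : G.Adj v r₂)
    exact hr (congrArg Subtype.val h)
  obtain ⟨u, hu, huniq⟩ := hv
  refine ⟨u, hu, fun y hy => ?_⟩
  refine congrArg Subtype.val (huniq ⟨y, ?_, ?_⟩ hy)
  · rintro rfl
    exact v.2.2 ((ha v).1 hy.symm)
  · rintro rfl
    exact ((hp v).1 hy.symm).elim v.2.1 hvq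

theorem leafCount_induce_pendant_lt [Finite V] (ha : ∀ x, G.Adj a x ↔ x = p)
    (hleaf : ∀ v, IsLeafVert (G.induce {x | x ≠ a ∧ x ≠ p}) v → IsLeafVert G v) :
    {v | IsLeafVert (G.induce {x | x ≠ a ∧ x ≠ p}) v}.ncard < {v | IsLeafVert G v}.ncard := by
  rw [← Set.ncard_image_of_injective _ Subtype.val_injective]
  refine Set.ncard_lt_ncard ((Set.ssubset_iff_of_subset ?_).2
    ⟨a, ⟨p, (ha p).2 rfl, fun y hy => (ha y).1 hy⟩, ?_⟩)
  · rintro _ ⟨v, hv, rfl⟩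
    exact hleaf v hv
  · rintro ⟨v, -, hv⟩
    exact v.2.1 hv

theorem supportCount_induce_pendant_lt [Finite V] (ha : ∀ x, G.Adj a x ↔ x = p)
    (hleaf : ∀ v, IsLeafVert (G.induce {x | x ≠ a ∧ x ≠ p}) v → IsLeafVert G v) :
    {v | IsSupportVert (G.induce {x | x ≠ a ∧ x ≠ p}) v}.ncard <
      {v | IsSupportVert G v}.ncard := by
  rw [← Set.ncard_image_of_injective _ Subtype.val_injective]
  refine Set.ncard_lt_ncard ((Set.ssubset_iff_of_subset ?_).2
    ⟨p, ⟨a, ((ha p).2 rfl).symm, p, (ha p).2 rfl, fun y hy => (ha y).1 hy⟩, ?_⟩)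
  · rintro _ ⟨v, ⟨u, hvu, hu⟩, rfl⟩
    exact ⟨u, hvu, hleaf u hu⟩
  · rintro ⟨v, -, hv⟩
    exact v.2.2 hv

end PendantPath

theorem claimII_lower {V : Type u} [Fintype V] [DecidableEq V]
    (T : SimpleGraph V) [DecidableRel T.Adj] (hT : T.IsTree) (hn : 3 ≤ Nat.card V)
    (heq : (toidNumber (subdivision T) : ℚ) = (4 * (Nat.card V : ℚ) - leafCount T - supportCount T) / 3)
    {a b : V} (w : T.Walk a b) (hw : w.IsPath) (hd : w.length = T.diam)
    (hdeg2 : T.degree (w.getVert 1) = 2) (hdeg3 : 3 ≤ T.degree (w.getVert 2)) :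
    (toidNumber (subdivision (T.induce {x : V | x ≠ a ∧ x ≠ w.getVert 1})) : ℚ) = (4 * (Nat.card {x : V | x ≠ a ∧ x ≠ w.getVert 1} : ℚ) - leafCount (T.induce {x : V | x ≠ a ∧ x ≠ w.getVert 1}) - supportCount (T.induce {x : V | x ≠ a ∧ x ≠ w.getVert 1})) / 3 := by
  have hlen : 2 ≤ w.length := by
    by_contra! hlt
    rw [w.getVert_of_length_le (i := 2) (by omega)] at hdeg3
    rw [w.getVert_of_length_le (i := 1) (by omega)] at hdeg2
    omega
  have ha := hT.adj_start_iff_of_length_eq_diam hw hd (by omega)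
  have hpq : T.Adj (w.getVert 1) (w.getVert 2) := w.adj_getVert_succ (by omega)
  have haq : a ≠ w.getVert 2 := by
    intro h
    have := hw.getVert_injOn (show 0 ∈ {i | i ≤ w.length} by simp)
      (show 2 ∈ {i | i ≤ w.length} from hlen) (by rw [← h, w.getVert_zero])
    omega
  generalize w.getVert 1 = p at *
  generalize w.getVert 2 = q at *
  have hap : T.Adj a p := (ha p).2 rfl
  have hp : ∀ x, T.Adj p x ↔ x = a ∨ x = q := by
    have hsub : ({a, q} : Finset V) ⊆ T.neighborFinset p := by
      simp [Finset.insert_subset_iff, hap.symm, hpq]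
    have hpair := Finset.eq_of_subset_of_card_le hsub
      (by rw [T.card_neighborFinset_eq_degree, hdeg2, Finset.card_pair haq])
    intro x
    rw [← T.mem_neighborFinset, ← hpair]
    simp
  obtain ⟨r₁, h₁, r₂, h₂, hr⟩ := Finset.one_lt_card.1 (show 1 < ((T.neighborFinset q).erase p).card by
    have := Finset.pred_card_le_card_erase (s := T.neighborFinset q) (a := p)
    rw [T.card_neighborFinset_eq_degree] at this
    omega)
  simp only [Finset.mem_erase, T.mem_neighborFinset] at h₁ h₂
  have hleaf : ∀ v, IsLeafVert (T.induce {x | x ≠ a ∧ x ≠ p}) v → IsLeafVert T v :=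
    fun v hv => hv.of_induce_pendant ha hp hr h₁.2 h₂.2 h₁.1 h₂.1 haq
  have hl := leafCount_induce_pendant_lt ha hleaf
  have hs := supportCount_induce_pendant_lt ha hleaf
  have hra : ∀ x, T.Adj q x → x ≠ a := by
    rintro x hx rfl
    exact hpq.ne' ((ha q).1 hx.symm)
  have hcard : Nat.card {x : V | x ≠ a ∧ x ≠ p} + 2 = Nat.card V := by
    have hset : {x : V | x ≠ a ∧ x ≠ p} = ({a, p} : Set V)ᶜ := by
      ext x
      simp
    rw [hset, Nat.card_coe_set_eq, ← Set.ncard_add_ncard_compl ({a, p} : Set V),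
      Set.ncard_pair hap.ne, add_comm]
  have hcard3 : 2 < Nat.card {x : V | x ≠ a ∧ x ≠ p} := by
    rw [Nat.card_coe_set_eq, Set.two_lt_ncard_iff]
    exact ⟨q, r₁, r₂, ⟨haq.symm, hpq.ne'⟩, ⟨hra _ h₁.2, h₁.1⟩, ⟨hra _ h₂.2, h₂.1⟩,
      h₁.2.ne, h₂.2.ne, hr⟩
  simp only [leafCount, supportCount, if_neg (show Nat.card V ≠ 2 by omega)] at heq
  simp only [leafCount, supportCount, if_neg hcard3.ne']
  have heq' : 3 * toidNumber (subdivision T) + {v | IsLeafVert T v}.ncard +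
      {v | IsSupportVert T v}.ncard = 4 * Nat.card V := by
    have : (3 * toidNumber (subdivision T) + {v | IsLeafVert T v}.ncard +
      {v | IsSupportVert T v}.ncard : ℚ) = 4 * Nat.card V := by
      rw [heq]
      ring
    exact_mod_cast this
  have : Nontrivial V := Finite.one_lt_card_iff_nontrivial.1 (by omega)
  have hT₀ : IsTOIDPair T T Set.univ := ⟨le_rfl, hT.connected.preconnected.exists_adj_of_nontrivial,
    fun _ _ _ => Or.inl trivial, fun _ _ _ => Or.inl trivial⟩
  obtain ⟨H, A, hHA, hHAcard⟩ := hT₀.exists_ncard_eq_toidNumber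
  obtain ⟨H', A', hHA', hle⟩ := hHA.exists_induce ha hp haq h₁.2 h₁.1
  have hub := hHA'.toidNumber_le
  obtain ⟨H₂, A₂, hHA₂, hcard₂⟩ := hHA'.exists_ncard_eq_toidNumber
  have hlb := hHA₂.four_mul_card_le
  have hfin : 3 * toidNumber (subdivision (T.induce {x | x ≠ a ∧ x ≠ p})) +
      {v | IsLeafVert (T.induce {x | x ≠ a ∧ x ≠ p}) v}.ncard +
      {v | IsSupportVert (T.induce {x | x ≠ a ∧ x ≠ p}) v}.ncard =
      4 * Nat.card {x : V | x ≠ a ∧ x ≠ p} := by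
    omega
  have hfinQ : (3 * toidNumber (subdivision (T.induce {x | x ≠ a ∧ x ≠ p})) +
      {v | IsLeafVert (T.induce {x | x ≠ a ∧ x ≠ p}) v}.ncard +
      {v | IsSupportVert (T.induce {x | x ≠ a ∧ x ≠ p}) v}.ncard : ℚ) =
      4 * Nat.card {x : V | x ≠ a ∧ x ≠ p} := by
    exact_mod_cast hfin
  linarith
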